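/- arXiv:0802.2852 — 2 statements merged into one kernel-verified Lean document; each statement's English description precedes it below -/
import Mathlib

section
/- For the deferred-decision Markov chain S, the one-step expected potential drop is uniformly bounded: there is a constant C (C = 7 works) such that for all 1 ≤ s ≤ n, (F(s)/s)·Φ(s) + Σ_{1≤x<s} (x/s)·(μ(x+1)+μ(s−x))·(Φ(s)−Φ(x)) ≤ C, where Φ(s) = Σ_{1≤a≤s} 1/(a·σ_a) and σ_a = Σ_{b≤a} μ(b)√(b/a) + Σ_{a<b≤n} μ(b)√(a/b). -/
/-- `σ_a = Σ_{1≤d≤a} μ(d)·√(d/a) + Σ_{a<d≤n} μ(d)·√(a/d)`. -/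
noncomputable def sigma (n : ℕ) (μ : ℕ → ℝ) (a : ℕ) : ℝ :=
  ∑ d ∈ Finset.Icc 1 a, μ d * Real.sqrt ((d : ℝ) / a) +
    ∑ d ∈ Finset.Ioc a n, μ d * Real.sqrt ((a : ℝ) / d)

/-- The potential `Φ(s) = Σ_{1≤a≤s} 1/(a·σ_a)`. -/
noncomputable def Phi (n : ℕ) (μ : ℕ → ℝ) (s : ℕ) : ℝ :=
  ∑ a ∈ Finset.Icc 1 s, 1 / ((a : ℝ) * sigma n μ a)

/-- The weight of `μ d` in `sigma n μ a`. -/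
noncomputable def sigmaKernel (a d : ℕ) : ℝ :=
  if d ≤ a then Real.sqrt ((d : ℝ) / a) else Real.sqrt ((a : ℝ) / d)

lemma sigma_eq_sum_sigmaKernel {n a : ℕ} (μ : ℕ → ℝ) (han : a ≤ n) :
    sigma n μ a = ∑ d ∈ Finset.Icc 1 n, μ d * sigmaKernel a d := by
  have hdisj : Disjoint (Finset.Icc 1 a) (Finset.Ioc a n) := by
    rw [Finset.disjoint_left]
    intro d hd hd'
    simp only [Finset.mem_Icc, Finset.mem_Ioc] at hd hd'
    omega
  have hunion : Finset.Icc 1 n = Finset.Icc 1 a ∪ Finset.Ioc a n := by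
    ext d
    simp only [Finset.mem_Icc, Finset.mem_Ioc, Finset.mem_union]
    omega
  rw [hunion, Finset.sum_union hdisj, sigma]
  congr 1
  · refine Finset.sum_congr rfl fun d hd => ?_
    rw [sigmaKernel, if_pos (Finset.mem_Icc.mp hd).2]
  · refine Finset.sum_congr rfl fun d hd => ?_
    rw [sigmaKernel, if_neg (by have := (Finset.mem_Ioc.mp hd).1; omega)]

lemma sigma_pos {n a : ℕ} {μ : ℕ → ℝ} (hμ0 : ∀ d, 0 ≤ μ d) (hμ1 : 0 < μ 1) (ha : 1 ≤ a) :
    0 < sigma n μ a := by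
  refine add_pos_of_pos_of_nonneg ?_
    (Finset.sum_nonneg fun d _ => mul_nonneg (hμ0 d) (Real.sqrt_nonneg _))
  refine Finset.sum_pos' (fun d _ => mul_nonneg (hμ0 d) (Real.sqrt_nonneg _))
    ⟨1, Finset.mem_Icc.mpr ⟨le_rfl, ha⟩, mul_pos hμ1 (Real.sqrt_pos.mpr ?_)⟩
  positivity

lemma sum_inv_sqrt_le (s : ℕ) :
    ∑ a ∈ Finset.Icc 1 s, 1 / Real.sqrt (a : ℝ) ≤ 2 * Real.sqrt s := by
  induction s with
  | zero => simp
  | succ k ih =>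
    rw [Finset.sum_Icc_succ_top (by omega)]
    have hpos : 0 < Real.sqrt ((k + 1 : ℕ) : ℝ) := Real.sqrt_pos.mpr (by positivity)
    have hsq : Real.sqrt ((k + 1 : ℕ) : ℝ) ^ 2 = k + 1 := by
      rw [Real.sq_sqrt (by positivity)]
      push_cast
      rfl
    have hsq' : Real.sqrt (k : ℝ) ^ 2 = k := Real.sq_sqrt (by positivity)
    have hstep : 1 / Real.sqrt ((k + 1 : ℕ) : ℝ) ≤
        2 * Real.sqrt ((k + 1 : ℕ) : ℝ) - 2 * Real.sqrt (k : ℝ) := by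
      rw [div_le_iff₀ hpos]
      nlinarith [sq_nonneg (Real.sqrt ((k + 1 : ℕ) : ℝ) - Real.sqrt (k : ℝ))]
    linarith

lemma sum_inv_sqrt_reflect_le (s : ℕ) :
    ∑ a ∈ Finset.Icc 1 s, 1 / Real.sqrt ((s + 1 - a : ℕ) : ℝ) ≤ 2 * Real.sqrt s := by
  refine le_of_eq_of_le ?_ (sum_inv_sqrt_le s)
  refine Finset.sum_nbij' (fun a => s + 1 - a) (fun a => s + 1 - a) ?_ ?_ ?_ ?_ ?_ <;>
  · intro a ha
    simp only [Finset.mem_Icc] at ha ⊢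
    try omega

/-- An upper bound for `s` times the coefficient of `1 / (a * sigma n μ a)` in the expected
potential drop, relative to `a * sigma n μ a`. -/
noncomputable def dropBound (s a : ℕ) : ℝ :=
  1 + 2 * Real.sqrt ((s : ℝ) / a) + Real.sqrt ((s : ℝ) / (s + 1 - a : ℕ))

lemma sum_dropBound_le (s : ℕ) : ∑ a ∈ Finset.Icc 1 s, dropBound s a ≤ 7 * s := by
  have h1 := mul_le_mul_of_nonneg_left (sum_inv_sqrt_le s) (Real.sqrt_nonneg (s : ℝ))
  have h2 := mul_le_mul_of_nonneg_left (sum_inv_sqrt_reflect_le s) (Real.sqrt_nonneg (s : ℝ))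
  have hsq : Real.sqrt (s : ℝ) * Real.sqrt s = s := Real.mul_self_sqrt (by positivity)
  have heq : ∑ a ∈ Finset.Icc 1 s, dropBound s a =
      s + 2 * (Real.sqrt s * ∑ a ∈ Finset.Icc 1 s, 1 / Real.sqrt (a : ℝ)) +
        Real.sqrt s * ∑ a ∈ Finset.Icc 1 s, 1 / Real.sqrt ((s + 1 - a : ℕ) : ℝ) := by
    simp only [dropBound, Finset.sum_add_distrib, Finset.mul_sum,
      Real.sqrt_div (Nat.cast_nonneg s), mul_one_div]
    simp
  rw [heq]
  nlinarith

lemma coeff_le_kernel_mul_dropBound {s a d : ℕ} (ha : 1 ≤ a) (has : a ≤ s) (hd : 1 ≤ d) :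
    (if d ≤ s then 1 else 0) + (if d ≤ a then (d : ℝ) - 1 else 0) +
        (if s < a + d ∧ d < s then (s : ℝ) - d else 0) ≤
      a * sigmaKernel a d * dropBound s a := by
  have ha0 : (0 : ℝ) < a := by exact_mod_cast ha
  have hd0 : (0 : ℝ) < d := by exact_mod_cast hd
  have has' : (a : ℝ) ≤ s := by exact_mod_cast has
  have hr0 : (0 : ℝ) < (s + 1 - a : ℕ) := by
    have : 0 < s + 1 - a := by omega
    exact_mod_cast this
  rw [dropBound]
  set p := Real.sqrt ((s : ℝ) / a) with hp
  set q := Real.sqrt ((s : ℝ) / (s + 1 - a : ℕ)) with hq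
  have hp0 : 0 ≤ p := Real.sqrt_nonneg _
  have hq0 : 0 ≤ q := Real.sqrt_nonneg _
  rw [sigmaKernel]
  by_cases hda : d ≤ a
  · have hda' : (d : ℝ) ≤ a := by exact_mod_cast hda
    rw [if_pos (hda.trans has), if_pos hda, if_pos hda]
    set k := Real.sqrt ((d : ℝ) / a) with hk
    have hk0 : 0 ≤ k := Real.sqrt_nonneg _
    have hdk : (d : ℝ) ≤ a * k := by
      have : (d : ℝ) / a ≤ k := by
        apply Real.le_sqrt_of_sq_le
        have h1 : (d : ℝ) / a ≤ 1 := (div_le_one ha0).mpr hda'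
        have h0 : 0 ≤ (d : ℝ) / a := by positivity
        nlinarith
      rw [div_le_iff₀ ha0] at this
      linarith
    have hlast : (if s < a + d ∧ d < s then (s : ℝ) - d else 0) ≤ a * k * q := by
      split_ifs with h
      · have hsad : (s : ℝ) - d ≤ a := by
          have : (s : ℝ) < a + d := by exact_mod_cast h.1
          linarith
        have hrd : ((s + 1 - a : ℕ) : ℝ) ≤ d := by
          have : s + 1 - a ≤ d := by omega
          exact_mod_cast this
        have hkq : 1 ≤ k * q := by
          rw [hk, hq, ← Real.sqrt_mul (by positivity), Real.one_le_sqrt, div_mul_div_comm,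
            one_le_div (by positivity)]
          nlinarith
        nlinarith
      · positivity
    have : 0 ≤ a * k * p := by positivity
    nlinarith
  · have hda' : (a : ℝ) < d := by exact_mod_cast not_le.mp hda
    rw [if_neg hda, if_neg hda]
    set k := Real.sqrt ((a : ℝ) / d) with hk
    have hk0 : 0 ≤ k := Real.sqrt_nonneg _
    have hkq : 0 ≤ a * k * q := by positivity
    have hak : 0 ≤ a * k := by positivity
    by_cases hds : d ≤ s
    · have hkp : 1 ≤ k * p := by
        rw [hk, hp, ← Real.sqrt_mul (by positivity), Real.one_le_sqrt, div_mul_div_comm,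
          one_le_div (by positivity)]
        have : (d : ℝ) ≤ s := by exact_mod_cast hds
        nlinarith
      have ha1 : (1 : ℝ) ≤ a := by exact_mod_cast ha
      have hakp : (a : ℝ) ≤ a * k * p := by nlinarith
      have hlast : (if s < a + d ∧ d < s then (s : ℝ) - d else 0) ≤ a := by
        split_ifs with h
        · have : (s : ℝ) < a + d := by exact_mod_cast h.1
          linarith
        · exact ha0.le
      rw [if_pos hds]
      nlinarith
    · rw [if_neg hds, if_neg (by omega)]
      have : 0 ≤ a * k * p := by positivity
      nlinarith

lemma drop_coeff_eq {n s a : ℕ} (μ : ℕ → ℝ) (hsn : s ≤ n) (has : a ≤ s) :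
    ∑ d ∈ Finset.Icc 1 s, μ d +
        ∑ x ∈ Finset.Ico 1 a, (x : ℝ) * (μ (x + 1) + μ (s - x)) =
      ∑ d ∈ Finset.Icc 1 n, μ d * ((if d ≤ s then 1 else 0) +
        (if d ≤ a then (d : ℝ) - 1 else 0) +
        (if s < a + d ∧ d < s then (s : ℝ) - d else 0)) := by
  have h1 : ∑ d ∈ Finset.Icc 1 s, μ d =
      ∑ d ∈ Finset.Icc 1 n, μ d * (if d ≤ s then 1 else 0) := by
    simp only [mul_ite, mul_one, mul_zero, ← Finset.sum_filter]
    refine Finset.sum_congr ?_ fun _ _ => rfl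
    ext d
    simp only [Finset.mem_Icc, Finset.mem_filter]
    omega
  have h2 : ∑ x ∈ Finset.Ico 1 a, (x : ℝ) * μ (x + 1) =
      ∑ d ∈ Finset.Icc 1 n, μ d * (if d ≤ a then (d : ℝ) - 1 else 0) := by
    refine Finset.sum_of_injOn (fun x => x + 1) (fun x _ y _ h => by simpa using h) ?_ ?_ ?_
    · intro x hx
      simp only [Finset.coe_Ico, Set.mem_Ico, Finset.coe_Icc, Set.mem_Icc] at hx ⊢
      omega
    · intro d hd hd'
      simp only [Finset.mem_Icc] at hd
      split_ifs with hda
      · have : d = 1 := by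
          by_contra hne
          refine hd' ⟨d - 1, ?_, ?_⟩
          · simp only [Finset.coe_Ico, Set.mem_Ico]
            omega
          · simp only
            omega
        simp [this]
      · simp
    · intro x hx
      simp only [Finset.mem_Ico] at hx
      rw [if_pos (by omega)]
      push_cast
      ring
  have h3 : ∑ x ∈ Finset.Ico 1 a, (x : ℝ) * μ (s - x) =
      ∑ d ∈ Finset.Icc 1 n, μ d * (if s < a + d ∧ d < s then (s : ℝ) - d else 0) := by
    refine Finset.sum_of_injOn (fun x => s - x) ?_ ?_ ?_ ?_
    · intro x hx y hy h
      simp only [Finset.coe_Ico, Set.mem_Ico] at hx hy h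
      omega
    · intro x hx
      simp only [Finset.coe_Ico, Set.mem_Ico, Finset.coe_Icc, Set.mem_Icc] at hx ⊢
      omega
    · intro d hd hd'
      rw [if_neg, mul_zero]
      rintro ⟨hl, hr⟩
      refine hd' ⟨s - d, ?_, ?_⟩
      · simp only [Finset.coe_Ico, Set.mem_Ico]
        omega
      · simp only
        omega
    · intro x hx
      simp only [Finset.mem_Ico] at hx
      rw [if_pos (by omega), Nat.cast_sub (by omega)]
      ring
  simp only [mul_add, Finset.sum_add_distrib]
  rw [h1, h2, h3, add_assoc]

lemma drop_coeff_le {n s a : ℕ} {μ : ℕ → ℝ} (hμ0 : ∀ d, 0 ≤ μ d) (hsn : s ≤ n)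
    (ha : 1 ≤ a) (has : a ≤ s) :
    ∑ d ∈ Finset.Icc 1 s, μ d +
        ∑ x ∈ Finset.Ico 1 a, (x : ℝ) * (μ (x + 1) + μ (s - x)) ≤
      dropBound s a * (a * sigma n μ a) := by
  rw [drop_coeff_eq μ hsn has, sigma_eq_sum_sigmaKernel μ (has.trans hsn), Finset.mul_sum,
    Finset.mul_sum]
  refine Finset.sum_le_sum fun d hd => ?_
  have := mul_le_mul_of_nonneg_left
    (coeff_le_kernel_mul_dropBound ha has (Finset.mem_Icc.mp hd).1) (hμ0 d)
  linarith

lemma Phi_sub_Phi (n : ℕ) (μ : ℕ → ℝ) {x s : ℕ} (hxs : x ≤ s) :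
    Phi n μ s - Phi n μ x = ∑ a ∈ Finset.Ioc x s, 1 / ((a : ℝ) * sigma n μ a) := by
  have hIcc : ∀ m : ℕ, Finset.Icc 1 m = Finset.Ioc 0 m := fun m => by
    ext
    simp [Nat.succ_le_iff]
  rw [Phi, Phi, hIcc, hIcc, sub_eq_iff_eq_add',
    Finset.sum_Ioc_consecutive _ (Nat.zero_le x) hxs]

lemma expected_drop_eq (n : ℕ) (μ : ℕ → ℝ) (s : ℕ) :
    (∑ d ∈ Finset.Icc 1 s, μ d) / (s : ℝ) * Phi n μ s +
        ∑ x ∈ Finset.Ico 1 s,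
          ((x : ℝ) / s) * (μ (x + 1) + μ (s - x)) * (Phi n μ s - Phi n μ x) =
      (∑ a ∈ Finset.Icc 1 s, (∑ d ∈ Finset.Icc 1 s, μ d +
        ∑ x ∈ Finset.Ico 1 a, (x : ℝ) * (μ (x + 1) + μ (s - x))) /
          ((a : ℝ) * sigma n μ a)) / s := by
  have hswap : ∑ x ∈ Finset.Ico 1 s,
        ((x : ℝ) / s) * (μ (x + 1) + μ (s - x)) * (Phi n μ s - Phi n μ x) =
      ∑ a ∈ Finset.Icc 1 s, ∑ x ∈ Finset.Ico 1 a,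
        ((x : ℝ) / s) * (μ (x + 1) + μ (s - x)) * (1 / ((a : ℝ) * sigma n μ a)) := by
    rw [Finset.sum_congr rfl fun x hx => by
      rw [Phi_sub_Phi n μ (Finset.mem_Ico.mp hx).2.le, Finset.mul_sum]]
    refine Finset.sum_comm' fun x a => ?_
    simp only [Finset.mem_Ico, Finset.mem_Ioc, Finset.mem_Icc]
    omega
  have hterm : ∀ a : ℕ,
      (∑ d ∈ Finset.Icc 1 s, μ d) / (s : ℝ) * (1 / ((a : ℝ) * sigma n μ a)) +
        ∑ x ∈ Finset.Ico 1 a,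
          ((x : ℝ) / s) * (μ (x + 1) + μ (s - x)) * (1 / ((a : ℝ) * sigma n μ a)) =
      (∑ d ∈ Finset.Icc 1 s, μ d +
        ∑ x ∈ Finset.Ico 1 a, (x : ℝ) * (μ (x + 1) + μ (s - x))) /
          ((a : ℝ) * sigma n μ a) / s := fun a => by
    rw [add_div, add_div, Finset.sum_div (Finset.Ico 1 a), Finset.sum_div (Finset.Ico 1 a)]
    congr 1
    · ring
    · exact Finset.sum_congr rfl fun x _ => by ring
  rw [hswap, Phi, Finset.mul_sum, ← Finset.sum_add_distrib,
    Finset.sum_congr rfl fun a _ => hterm a, ← Finset.sum_div]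

/-- Main Lemma: the one-step expected potential drop of the deferred-decision process `S`
is uniformly bounded by a constant (`C = 7` works): for all `1 ≤ s ≤ n`,
`(F(s)/s)·Φ(s) + Σ_{1≤x<s} (x/s)·(μ(x+1)+μ(s-x))·(Φ(s) - Φ(x)) ≤ 7`. -/
theorem stmt17 (n : ℕ) (hn : 1 ≤ n) (μ : ℕ → ℝ)
    (hμ0 : ∀ d, 0 ≤ μ d)
    (hsupp : ∀ d, d ∉ Finset.Icc 1 n → μ d = 0)
    (hsum : ∑ d ∈ Finset.Icc 1 n, μ d = 1)
    (hμ1 : 0 < μ 1)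
    (s : ℕ) (hs : s ∈ Finset.Icc 1 n) :
    (∑ d ∈ Finset.Icc 1 s, μ d) / (s : ℝ) * Phi n μ s +
      ∑ x ∈ Finset.Ico 1 s, ((x : ℝ) / s) * (μ (x + 1) + μ (s - x)) * (Phi n μ s - Phi n μ x)
      ≤ 7 := by
  obtain ⟨hs1, hsn⟩ := Finset.mem_Icc.mp hs
  have hs0 : (0 : ℝ) < s := by exact_mod_cast hs1
  rw [expected_drop_eq, div_le_iff₀ hs0]
  refine (Finset.sum_le_sum fun a ha => ?_).trans (sum_dropBound_le s)
  obtain ⟨ha1, has⟩ := Finset.mem_Icc.mp ha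
  have ha0 : (0 : ℝ) < a := by exact_mod_cast ha1
  rw [div_le_iff₀ (mul_pos ha0 (sigma_pos hμ0 hμ1 ha1))]
  exact drop_coeff_le hμ0 hsn ha1 has
end

section
/- For every probability distribution μ on {1,...,n}, the expected hitting time of 0 for the token process started uniformly on {1,...,n} satisfies E_μ(T) = Ω((log n)²); i.e., there is an absolute constant c > 0 with E_μ(T) ≥ c·(log n)² for all n ≥ 2 and all μ. -/
/-- The `μ`-average of `d / max b d ^ 2`; the speed of the logarithm of the position at scale `b`
is of order `b * scaleWeight n μ b`. -/
noncomputable def scaleWeight (n : ℕ) (μ : ℕ → ℝ) (b : ℕ) : ℝ :=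
  ∑ d ∈ Finset.Icc 1 n, μ d * ((d : ℝ) / (max b d : ℝ) ^ 2)

/-- The potential `∑ b ≤ a, 1 / (b ^ 2 * scaleWeight n μ b)`. -/
noncomputable def potential (n : ℕ) (μ : ℕ → ℝ) (a : ℕ) : ℝ :=
  ∑ b ∈ Finset.Icc 1 a, 1 / ((b : ℝ) ^ 2 * scaleWeight n μ b)

section

variable {n : ℕ} {μ : ℕ → ℝ}

lemma scaleWeight_antitone (hμ : ∀ d, 0 ≤ μ d) : Antitone (scaleWeight n μ) := by
  intro b a hba
  unfold scaleWeight
  refine Finset.sum_le_sum fun d hd => mul_le_mul_of_nonneg_left ?_ (hμ d)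
  have hd1 : (0 : ℝ) < d := by exact_mod_cast (Finset.mem_Icc.mp hd).1
  have h : (b : ℝ) ≤ a := by exact_mod_cast hba
  have : (0 : ℝ) < max (b : ℝ) d := lt_max_of_lt_right hd1
  gcongr

lemma sum_mul_le_sq_mul_scaleWeight (hμ : ∀ d, 0 ≤ μ d) {a : ℕ} (ha : 1 ≤ a) (han : a ≤ n) :
    ∑ d ∈ Finset.Icc 1 a, μ d * d ≤ (a : ℝ) ^ 2 * scaleWeight n μ a := by
  have ha0 : (0 : ℝ) < a := by exact_mod_cast ha
  unfold scaleWeight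
  rw [Finset.mul_sum]
  calc ∑ d ∈ Finset.Icc 1 a, μ d * d
      = ∑ d ∈ Finset.Icc 1 a, (a : ℝ) ^ 2 * (μ d * ((d : ℝ) / (max a d : ℝ) ^ 2)) := by
        refine Finset.sum_congr rfl fun d hd => ?_
        have h : (d : ℝ) ≤ a := by exact_mod_cast (Finset.mem_Icc.mp hd).2
        rw [max_eq_left h]
        field_simp
    _ ≤ _ := by
        refine Finset.sum_le_sum_of_subset_of_nonneg (Finset.Icc_subset_Icc_right han) ?_
        intro d _ _
        have := hμ d
        positivity

lemma scaleWeight_pos (hμ : ∀ d, 0 ≤ μ d) (h1 : 0 < μ 1) {a : ℕ} (ha : 1 ≤ a) (han : a ≤ n) :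
    0 < scaleWeight n μ a := by
  have ha0 : (0 : ℝ) < a := by exact_mod_cast ha
  have h := sum_mul_le_sq_mul_scaleWeight hμ ha han
  have h2 : μ 1 * (1 : ℕ) ≤ ∑ d ∈ Finset.Icc 1 a, μ d * d :=
    Finset.single_le_sum (f := fun d => μ d * (d : ℝ))
      (fun d _ => mul_nonneg (hμ d) d.cast_nonneg) (Finset.mem_Icc.mpr ⟨le_rfl, ha⟩)
  have h3 : 0 < (a : ℝ) ^ 2 * scaleWeight n μ a := by
    push_cast at h2
    linarith
  exact pos_of_mul_pos_right h3 (by positivity)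

lemma sum_div_max_sq_le (N : ℕ) {d : ℕ} (hd : 1 ≤ d) :
    ∑ b ∈ Finset.Icc 1 N, (d : ℝ) / (max b d : ℝ) ^ 2 ≤ 4 * (N / (N + d)) := by
  have hd0 : (1 : ℝ) ≤ d := by exact_mod_cast hd
  induction N with
  | zero => simp
  | succ N ih =>
    rw [Finset.sum_Icc_succ_top (by omega)]
    have hN : (0 : ℝ) ≤ N := N.cast_nonneg
    have hm1 := le_max_left ((N + 1 : ℕ) : ℝ) (d : ℝ)
    have hm2 := le_max_right ((N + 1 : ℕ) : ℝ) (d : ℝ)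
    set m := max ((N + 1 : ℕ) : ℝ) (d : ℝ)
    push_cast at hm1 ⊢
    have hstep : (4 : ℝ) * ((N + 1) / (N + 1 + d)) - 4 * (N / (N + d))
        = d / ((N + 1 + d) * (N + d) / 4) := by
      field_simp
      ring
    have : (d : ℝ) / m ^ 2 ≤ d / ((N + 1 + d) * (N + d) / 4) := by
      apply div_le_div_of_nonneg_left (by linarith) (by positivity)
      nlinarith
    linarith

lemma sum_scaleWeight_le (hμ : ∀ d, 0 ≤ μ d) (hsum : ∑ d ∈ Finset.Icc 1 n, μ d = 1) (N : ℕ) :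
    ∑ b ∈ Finset.Icc 1 N, scaleWeight n μ b ≤ 4 := by
  unfold scaleWeight
  rw [Finset.sum_comm]
  calc _ ≤ ∑ d ∈ Finset.Icc 1 n, μ d * 4 := by
        refine Finset.sum_le_sum fun d hd => ?_
        rw [← Finset.mul_sum]
        refine mul_le_mul_of_nonneg_left ?_ (hμ d)
        refine (sum_div_max_sq_le N (Finset.mem_Icc.mp hd).1).trans ?_
        have : (N : ℝ) / (N + d) ≤ 1 := div_le_one_of_le₀ (by simp) (by positivity)
        linarith
    _ = 4 := by rw [← Finset.sum_mul, hsum, one_mul]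

lemma log_sq_le_potential (hμ : ∀ d, 0 ≤ μ d) (hsum : ∑ d ∈ Finset.Icc 1 n, μ d = 1)
    (h1 : 0 < μ 1) (hn : 1 ≤ n) : Real.log n ^ 2 ≤ 4 * potential n μ n := by
  have hcs : (∑ b ∈ Finset.Icc 1 n, 1 / (b : ℝ)) ^ 2
      ≤ potential n μ n * ∑ b ∈ Finset.Icc 1 n, scaleWeight n μ b := by
    have hpos : ∀ b ∈ Finset.Icc 1 n, 0 < (b : ℝ) ∧ 0 < scaleWeight n μ b := fun b hb => by
      obtain ⟨hb1, hbn⟩ := Finset.mem_Icc.mp hb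
      exact ⟨by exact_mod_cast hb1, scaleWeight_pos hμ h1 hb1 hbn⟩
    refine Finset.sum_sq_le_sum_mul_sum_of_sq_le_mul _ (fun b hb => ?_)
      (fun b hb => (hpos b hb).2.le) (fun b hb => ?_)
    · have := (hpos b hb).2
      positivity
    · obtain ⟨h, h'⟩ := hpos b hb
      apply le_of_eq
      field_simp
  have hlog : Real.log n ≤ ∑ b ∈ Finset.Icc 1 n, 1 / (b : ℝ) := by
    have h := log_add_one_le_harmonic n
    rw [harmonic_eq_sum_Icc] at h
    push_cast at h
    simp only [one_div]
    refine le_trans (Real.log_le_log (by exact_mod_cast hn) ?_) h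
    linarith
  have hlog0 : 0 ≤ Real.log n := Real.log_natCast_nonneg n
  have hpot : 0 ≤ potential n μ n := by
    refine Finset.sum_nonneg fun b hb => ?_
    obtain ⟨hb1, hbn⟩ := Finset.mem_Icc.mp hb
    have := scaleWeight_pos hμ h1 hb1 hbn
    positivity
  calc Real.log n ^ 2 ≤ (∑ b ∈ Finset.Icc 1 n, 1 / (b : ℝ)) ^ 2 := by gcongr
    _ ≤ _ := hcs
    _ ≤ potential n μ n * 4 := by
        gcongr
        exact sum_scaleWeight_le hμ hsum n
    _ = _ := mul_comm _ _

lemma sum_mul_potential_sub (μ φ : ℕ → ℝ) (a : ℕ) :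
    ∑ d ∈ Finset.Icc 1 a,
        μ d * (d * (∑ b ∈ Finset.Icc 1 a, φ b - ∑ b ∈ Finset.Icc 1 (d - 1), φ b))
      = ∑ b ∈ Finset.Icc 1 a, φ b * ∑ d ∈ Finset.Icc 1 b, μ d * d := by
  induction a with
  | zero => simp
  | succ a ih =>
    rw [Finset.sum_Icc_succ_top (f := fun b => φ b * ∑ d ∈ Finset.Icc 1 b, μ d * d) (by omega),
      ← ih, Finset.sum_Icc_succ_top (by omega), Finset.sum_Icc_succ_top (f := φ) (by omega),
      Finset.sum_Icc_succ_top (f := fun d => μ d * d) (by omega), mul_add, Finset.mul_sum,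
      ← add_assoc, ← Finset.sum_add_distrib]
    congr 1
    · refine Finset.sum_congr rfl fun d _ => ?_
      ring
    · simp only [Nat.add_sub_cancel]
      ring

lemma succ_mul_sum_one_div_sq_le (e d : ℕ) :
    ((e : ℝ) + 1) * (∑ b ∈ Finset.Icc 1 (e + d), 1 / (b : ℝ) ^ 2
        - ∑ b ∈ Finset.Icc 1 e, 1 / (b : ℝ) ^ 2)
      ≤ 2 * d / (e + d + 1) := by
  induction d with
  | zero => simp
  | succ d ih =>
    rw [← add_assoc, Finset.sum_Icc_succ_top (by omega)]
    have he : (0 : ℝ) ≤ e := e.cast_nonneg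
    have hd : (0 : ℝ) ≤ d := d.cast_nonneg
    have h : ((e : ℝ) + 1) * (1 / ((e + d + 1 : ℕ) : ℝ) ^ 2)
        ≤ 2 * (d + 1 : ℕ) / (e + (d + 1 : ℕ) + 1) - 2 * d / (e + d + 1) := by
      push_cast
      rw [div_sub_div _ _ (by positivity) (by positivity), mul_one_div,
        div_le_div_iff₀ (by positivity) (by positivity)]
      have : 0 ≤ ((e : ℝ) + 1) * (e + d + 1) ^ 2 * (e + d) := by positivity
      nlinarith
    linarith

lemma mul_potential_sub_le (hμ : ∀ d, 0 ≤ μ d) (h1 : 0 < μ 1) {a : ℕ} (ha : 1 ≤ a) (han : a ≤ n)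
    {d : ℕ} (hd : d ≤ a) :
    ((a - d : ℕ) + 1 : ℝ) * (potential n μ a - potential n μ (a - d))
      ≤ 2 * d / (a + 1) / scaleWeight n μ a := by
  have hpos := scaleWeight_pos hμ h1 ha han
  obtain ⟨e, rfl⟩ : ∃ e, a = e + d := ⟨a - d, by omega⟩
  rw [Nat.add_sub_cancel]
  have hsplit : ∀ φ : ℕ → ℝ, ∑ b ∈ Finset.Icc 1 (e + d), φ b - ∑ b ∈ Finset.Icc 1 e, φ b
      = ∑ b ∈ Finset.Icc (e + 1) (e + d), φ b := fun φ => by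
    rw [sub_eq_iff_eq_add, ← Finset.sum_union]
    · congr 1
      ext b
      simp only [Finset.mem_union, Finset.mem_Icc]
      omega
    · exact Finset.disjoint_left.mpr fun b hb hb' => by
        simp only [Finset.mem_Icc] at hb hb'
        omega
  have hle : potential n μ (e + d) - potential n μ e
      ≤ (∑ b ∈ Finset.Icc 1 (e + d), 1 / (b : ℝ) ^ 2 - ∑ b ∈ Finset.Icc 1 e, 1 / (b : ℝ) ^ 2)
        / scaleWeight n μ (e + d) := by
    unfold potential
    rw [hsplit, hsplit, Finset.sum_div]
    refine Finset.sum_le_sum fun b hb => ?_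
    obtain ⟨hb1, hb2⟩ := Finset.mem_Icc.mp hb
    have hb0 : (0 : ℝ) < b := by exact_mod_cast (by omega : 0 < b)
    have := scaleWeight_antitone (n := n) hμ hb2
    rw [div_div]
    gcongr
  calc _ ≤ ((e : ℝ) + 1) * _ := mul_le_mul_of_nonneg_left hle (by positivity)
    _ = ((e : ℝ) + 1) * (∑ b ∈ Finset.Icc 1 (e + d), 1 / (b : ℝ) ^ 2
          - ∑ b ∈ Finset.Icc 1 e, 1 / (b : ℝ) ^ 2) / scaleWeight n μ (e + d) := by
        rw [mul_div_assoc]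
    _ ≤ _ := by
        push_cast
        gcongr
        exact succ_mul_sum_one_div_sq_le e d

/-- One-step drift bound for the potential, for the process on the right ends of intervals: a step
`d` splits the uniform law on `{0, ..., a}` into those on `{0, ..., d - 1}` and
`{0, ..., a - d}`. -/
lemma potential_drift_le (hμ : ∀ d, 0 ≤ μ d) (h1 : 0 < μ 1) {a : ℕ} (ha : 1 ≤ a) (han : a ≤ n) :
    ∑ d ∈ Finset.Icc 1 a, μ d * (d * (potential n μ a - potential n μ (d - 1))
      + ((a - d : ℕ) + 1) * (potential n μ a - potential n μ (a - d))) ≤ 3 * a := by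
  have ha0 : (0 : ℝ) < a := by exact_mod_cast ha
  simp only [mul_add (μ _), Finset.sum_add_distrib]
  have hlow : ∑ d ∈ Finset.Icc 1 a, μ d * (d * (potential n μ a - potential n μ (d - 1))) ≤ a := by
    unfold potential
    rw [sum_mul_potential_sub]
    calc _ ≤ ∑ b ∈ Finset.Icc 1 a, (1 : ℝ) := by
          refine Finset.sum_le_sum fun b hb => ?_
          obtain ⟨hb1, hba⟩ := Finset.mem_Icc.mp hb
          have hb0 : (0 : ℝ) < b := by exact_mod_cast hb1
          have hpos := scaleWeight_pos hμ h1 hb1 (hba.trans han)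
          rw [one_div_mul_eq_div, div_le_one (by positivity)]
          exact sum_mul_le_sq_mul_scaleWeight hμ hb1 (hba.trans han)
      _ = a := by simp
  have hhigh : ∑ d ∈ Finset.Icc 1 a,
      μ d * (((a - d : ℕ) + 1) * (potential n μ a - potential n μ (a - d))) ≤ 2 * a := by
    have hpos := scaleWeight_pos hμ h1 ha han
    calc _ ≤ ∑ d ∈ Finset.Icc 1 a, μ d * (2 * d / (a + 1) / scaleWeight n μ a) :=
          Finset.sum_le_sum fun d hd => mul_le_mul_of_nonneg_left
            (mul_potential_sub_le hμ h1 ha han (Finset.mem_Icc.mp hd).2) (hμ d)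
      _ = (∑ d ∈ Finset.Icc 1 a, μ d * d) * (2 / (a + 1) / scaleWeight n μ a) := by
          rw [Finset.sum_mul]
          refine Finset.sum_congr rfl fun d _ => ?_
          ring
      _ ≤ ((a : ℝ) ^ 2 * scaleWeight n μ a) * (2 / (a + 1) / scaleWeight n μ a) := by
          gcongr
          exact sum_mul_le_sq_mul_scaleWeight hμ ha han
      _ = 2 * a * (a / (a + 1)) := by field_simp
      _ ≤ 2 * a * 1 := by
          gcongr
          exact div_le_one_of_le₀ (by linarith) (by positivity)
      _ = 2 * a := mul_one _
  linarith

/-- Summing the one-step recurrence over `{0, ..., a}`. -/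
lemma sum_mul_sum_hittingTime {T : ℕ → ℝ} (hT0 : T 0 = 0)
    (hT : ∀ a ∈ Finset.Icc 1 n,
      (∑ d ∈ Finset.Icc 1 a, μ d) * T a = 1 + ∑ d ∈ Finset.Icc 1 a, μ d * T (a - d))
    {a : ℕ} (han : a ≤ n) :
    (∑ d ∈ Finset.Icc 1 a, μ d) * ∑ b ∈ Finset.Icc 1 a, T b = a + ∑ d ∈ Finset.Icc 1 a,
      μ d * (∑ b ∈ Finset.Icc 1 (d - 1), T b + ∑ b ∈ Finset.Icc 1 (a - d), T b) := by
  induction a with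
  | zero => simp
  | succ a ih =>
    have hrec := hT (a + 1) (Finset.mem_Icc.mpr ⟨by omega, han⟩)
    have hprev := ih (by omega)
    have hsum : ∑ d ∈ Finset.Icc 1 a,
        μ d * (∑ b ∈ Finset.Icc 1 (d - 1), T b + ∑ b ∈ Finset.Icc 1 (a + 1 - d), T b)
        = ∑ d ∈ Finset.Icc 1 a,
          μ d * (∑ b ∈ Finset.Icc 1 (d - 1), T b + ∑ b ∈ Finset.Icc 1 (a - d), T b)
          + ∑ d ∈ Finset.Icc 1 a, μ d * T (a + 1 - d) := by
      rw [← Finset.sum_add_distrib]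
      refine Finset.sum_congr rfl fun d hd => ?_
      have hd2 := (Finset.mem_Icc.mp hd).2
      rw [Nat.sub_add_comm hd2, Finset.sum_Icc_succ_top (by omega)]
      ring
    rw [Finset.sum_Icc_succ_top (by omega), Finset.sum_Icc_succ_top (by omega)] at hrec
    rw [Finset.sum_Icc_succ_top (by omega), Finset.sum_Icc_succ_top (f := T) (by omega),
      Finset.sum_Icc_succ_top (by omega), hsum]
    simp only [Nat.sub_self, hT0, Nat.add_sub_cancel] at hrec ⊢
    simp only [Finset.Icc_eq_empty_of_lt Nat.zero_lt_one, Finset.sum_empty]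
    push_cast
    linear_combination hprev + hrec

lemma potential_le_sum_hittingTime (hμ : ∀ d, 0 ≤ μ d) (h1 : 0 < μ 1) {T : ℕ → ℝ} (hT0 : T 0 = 0)
    (hT : ∀ a ∈ Finset.Icc 1 n,
      (∑ d ∈ Finset.Icc 1 a, μ d) * T a = 1 + ∑ d ∈ Finset.Icc 1 a, μ d * T (a - d))
    {a : ℕ} (han : a ≤ n) :
    ((a : ℝ) + 1) * potential n μ a ≤ 3 * ∑ b ∈ Finset.Icc 1 a, T b := by
  induction a using Nat.strong_induction_on with
  | _ a ih =>
    rcases Nat.eq_zero_or_pos a with rfl | ha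
    · simp [potential]
    have hF : 0 < ∑ d ∈ Finset.Icc 1 a, μ d := h1.trans_le
      (Finset.single_le_sum (fun d _ => hμ d) (Finset.mem_Icc.mpr ⟨le_rfl, ha⟩))
    have hdrift := potential_drift_le hμ h1 ha han
    have hrec := sum_mul_sum_hittingTime hT0 hT han
    refine le_of_mul_le_mul_left ?_ hF
    have hsplit : ∑ d ∈ Finset.Icc 1 a, μ d * (d * (potential n μ a - potential n μ (d - 1))
        + ((a - d : ℕ) + 1) * (potential n μ a - potential n μ (a - d)))
        = (∑ d ∈ Finset.Icc 1 a, μ d) * (((a : ℝ) + 1) * potential n μ a)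
          - ∑ d ∈ Finset.Icc 1 a, μ d * (d * potential n μ (d - 1)
            + ((a - d : ℕ) + 1) * potential n μ (a - d)) := by
      rw [Finset.sum_mul, ← Finset.sum_sub_distrib]
      refine Finset.sum_congr rfl fun d hd => ?_
      rw [Nat.cast_sub (Finset.mem_Icc.mp hd).2]
      ring
    have hind : ∑ d ∈ Finset.Icc 1 a, μ d * (d * potential n μ (d - 1)
          + ((a - d : ℕ) + 1) * potential n μ (a - d))
        ≤ 3 * ∑ d ∈ Finset.Icc 1 a,
          μ d * (∑ b ∈ Finset.Icc 1 (d - 1), T b + ∑ b ∈ Finset.Icc 1 (a - d), T b) := by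
      rw [Finset.mul_sum]
      refine Finset.sum_le_sum fun d hd => ?_
      obtain ⟨hd1, hda⟩ := Finset.mem_Icc.mp hd
      have hl := ih (d - 1) (by omega) (by omega)
      have hr := ih (a - d) (by omega) (by omega)
      have hcast : ((d - 1 : ℕ) : ℝ) + 1 = d := by exact_mod_cast Nat.sub_add_cancel hd1
      rw [hcast] at hl
      have := mul_le_mul_of_nonneg_left (add_le_add hl hr) (hμ d)
      linarith
    linarith

end


/-- Main theorem: for every probability distribution `μ` on `[1,n]`, the expected hitting
time of `0` for the token process started uniformly on `[1,n]` is `Ω((log n)²)`: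
there is an absolute constant `c > 0` such that `E_μ(T) ≥ c·(log n)²` for all `n ≥ 2`
and all `μ`. (`T` is the vector of expected hitting times, characterized by `T 0 = 0`
and the one-step recurrence `F(a)·T a = 1 + Σ_{1≤d≤a} μ(d)·T (a-d)`.) -/
theorem stmt19 : ∃ c > 0, ∀ n : ℕ, 2 ≤ n → ∀ μ : ℕ → ℝ,
    (∀ d, 0 ≤ μ d) → (∀ d, d ∉ Finset.Icc 1 n → μ d = 0) →
    (∑ d ∈ Finset.Icc 1 n, μ d = 1) →
    ∀ T : ℕ → ℝ, T 0 = 0 →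
    (∀ a ∈ Finset.Icc 1 n,
      (∑ d ∈ Finset.Icc 1 a, μ d) * T a = 1 + ∑ d ∈ Finset.Icc 1 a, μ d * T (a - d)) →
    c * Real.log n ^ 2 ≤ (1 / (n : ℝ)) * ∑ a ∈ Finset.Icc 1 n, T a := by
  refine ⟨1 / 12, by norm_num, fun n hn μ hμ _ hsum T hT0 hT => ?_⟩
  have h1 : 0 < μ 1 := by
    have h := hT 1 (Finset.mem_Icc.mpr ⟨le_rfl, by omega⟩)
    refine (hμ 1).lt_of_ne fun h0 => ?_
    simp [hT0, ← h0] at h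
  have hn0 : (0 : ℝ) < n := by exact_mod_cast (by omega : 0 < n)
  have hlog := log_sq_le_potential hμ hsum h1 (by omega)
  have hpot := potential_le_sum_hittingTime hμ h1 hT0 hT le_rfl
  rw [one_div_mul_eq_div (n : ℝ), le_div_iff₀ hn0]
  nlinarith [sq_nonneg (Real.log n)]
end
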